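/- Let R be an associative unital ℂ-algebra, let N be a natural number, and let a, b : {1,…,N} → R and c : {1,…,N}×{1,…,N} → ℂ satisfy: a_i·a_j = a_j·a_i for all i, j; b_i·b_j = b_j·b_i for all i, j; and a_i·b_j = b_j·a_i + c_{ij}·1 for all i, j. Then the ordered product (a_1 + b_1)·(a_2 + b_2)·⋯·(a_N + b_N) equals the sum, over all subsets Y ⊆ {1,…,N}, all subsets D ⊆ Y, and all injective maps f : D → Yᶜ (where Yᶜ = {1,…,N}∖Y) such that f(i) < i for every i ∈ D, of (−1)^{|D|} · (∏_{i∈D} c_{i,f(i)}) · (∏_{i ∈ Y∖D} a_i) · (∏_{j ∈ Yᶜ∖f(D)} b_j), where the products ∏ a_i and ∏ b_j are well defined because their factors pairwise commute. -/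

import Mathlib

/-- Product of the values of `f` over a finset of indices, taken in increasing index
order.  When the relevant values of `f` pairwise commute, this represents the
(unambiguous) product `∏_{i ∈ S} f i`. -/
noncomputable def orderedFinsetProd {R : Type*} [Monoid R] {N : ℕ}
    (S : Finset (Fin N)) (f : Fin N → R) : R :=
  ((S.sort (· ≤ ·)).map f).prod

/-- For a pairwise commuting family, the ordered product over a finset with one index added
splits off the corresponding factor on the right. -/
lemma orderedFinsetProd_insert_right {R : Type*} [Monoid R] {N : ℕ} {f : Fin N → R}
    (hf : ∀ i j, f i * f j = f j * f i) {S : Finset (Fin N)} {m : Fin N} (hm : m ∉ S) :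
    orderedFinsetProd (insert m S) f = orderedFinsetProd S f * f m := by
  have key : ∀ T : Finset (Fin N),
      orderedFinsetProd T f = T.noncommProd f (fun i _ j _ _ => hf i j) := by
    intro T
    have h := Finset.noncommProd_toFinset (T.sort (· ≤ ·)) f (fun i _ j _ _ => hf i j)
      (T.sort_nodup (· ≤ ·))
    simp only [Finset.sort_toFinset] at h
    exact h.symm
  rw [key, key]
  exact Finset.noncommProd_insert_of_notMem' _ _ _ _ hm

/-- The ordered product over a finset with a strictly largest index added splits off the
corresponding factor on the right, without any commutation hypothesis. -/
lemma orderedFinsetProd_insert_max {R : Type*} [Monoid R] {N : ℕ} (f : Fin N → R)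
    {S : Finset (Fin N)} {m : Fin N} (hm : ∀ i ∈ S, i < m) :
    orderedFinsetProd (insert m S) f = orderedFinsetProd S f * f m := by
  have hmS : m ∉ S := fun h => lt_irrefl _ (hm m h)
  have h : (insert m S).sort (· ≤ ·) = S.sort (· ≤ ·) ++ [m] := by
    refine List.Perm.eq_of_pairwise' (r := (· ≤ ·)) ((insert m S).pairwise_sort (· ≤ ·)) ?_ ?_
    · rw [List.pairwise_append]
      refine ⟨S.pairwise_sort (· ≤ ·), List.pairwise_singleton _ _, ?_⟩
      intro i hi j hj
      rw [List.mem_singleton] at hj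
      subst hj
      exact (hm i ((Finset.mem_sort _).1 hi)).le
    · rw [List.perm_ext_iff_of_nodup ((insert m S).sort_nodup (· ≤ ·))]
      · intro i
        simp [or_comm]
      · rw [List.nodup_append]
        refine ⟨S.sort_nodup (· ≤ ·), List.nodup_singleton _, ?_⟩
        intro i hi j hj hij
        rw [List.mem_singleton] at hj
        exact hmS ((Finset.mem_sort (· ≤ ·)).1 (hj ▸ hij ▸ hi))
  simp [orderedFinsetProd, h]

/-- Moving `x` to the left through an ordered product of factors with which its commutators
are scalars. -/
lemma orderedFinsetProd_mul_of_commutator {R : Type*} [Ring R] [Algebra ℂ R] {N : ℕ}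
    {b : Fin N → R} (hb : ∀ i j, b i * b j = b j * b i) {x : R} {d : Fin N → ℂ}
    (hx : ∀ j, x * b j = b j * x + algebraMap ℂ R (d j)) (S : Finset (Fin N)) :
    orderedFinsetProd S b * x =
      x * orderedFinsetProd S b - ∑ j ∈ S, d j • orderedFinsetProd (S.erase j) b := by
  induction S using Finset.induction_on with
  | empty => simp [orderedFinsetProd]
  | insert k S hk ih =>
    have hx' : b k * x = x * b k - algebraMap ℂ R (d k) := by rw [hx]; abel
    have hsum : ∑ j ∈ S, d j • orderedFinsetProd ((insert k S).erase j) b =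
        (∑ j ∈ S, d j • orderedFinsetProd (S.erase j) b) * b k := by
      rw [Finset.sum_mul]
      refine Finset.sum_congr rfl fun j hj => ?_
      have hjk : k ≠ j := fun h => hk (h ▸ hj)
      rw [Finset.erase_insert_of_ne hjk,
        orderedFinsetProd_insert_right hb (fun h => hk (Finset.mem_of_mem_erase h)),
        smul_mul_assoc]
    rw [Finset.sum_insert hk, Finset.erase_insert hk, hsum, orderedFinsetProd_insert_right hb hk,
      mul_assoc, hx', mul_sub, ← mul_assoc, ih, ← Algebra.commutes, ← Algebra.smul_def, sub_mul,
      mul_assoc]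
    abel

/-- The injective maps `f` from `D` to `s \ Y` with `f i < i`, extended by the identity off `D`. -/
def decreasingMatchings {N : ℕ} (s Y D : Finset (Fin N)) : Finset (Fin N → Fin N) :=
  Finset.univ.filter fun f => (∀ i ∈ D, f i ∈ s \ Y ∧ f i < i) ∧
    (∀ i ∈ D, ∀ j ∈ D, f i = f j → i = j) ∧ (∀ i ∉ D, f i = i)

lemma mem_decreasingMatchings {N : ℕ} {s Y D : Finset (Fin N)} {f : Fin N → Fin N} :
    f ∈ decreasingMatchings s Y D ↔ (∀ i ∈ D, f i ∈ s \ Y ∧ f i < i) ∧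
      (∀ i ∈ D, ∀ j ∈ D, f i = f j → i = j) ∧ (∀ i ∉ D, f i = i) := by
  simp [decreasingMatchings]

lemma decreasingMatchings_insert_left {N : ℕ} {s Y D : Finset (Fin N)} {m : Fin N}
    (hm : ∀ i ∈ D, i < m) :
    decreasingMatchings (insert m s) Y D = decreasingMatchings s Y D := by
  ext f
  simp only [mem_decreasingMatchings]
  refine and_congr_left fun _ => forall₂_congr fun i hi => and_congr_left fun hfi => ?_
  have : f i ≠ m := (hfi.trans (hm i hi)).ne
  simp [this]

lemma decreasingMatchings_insert_insert {N : ℕ} {s Y D : Finset (Fin N)} {m : Fin N}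
    (hm : m ∉ s) :
    decreasingMatchings (insert m s) (insert m Y) D = decreasingMatchings s Y D := by
  have : insert m s \ insert m Y = s \ Y := by
    ext i
    by_cases h : i = m
    · subst h; simp [hm]
    · simp [h]
  ext f
  simp only [mem_decreasingMatchings, this]

/-- A matching of `insert m D`, with `m` larger than every index in `s`, amounts to a matching
of `D` together with an unmatched partner for `m`. -/
lemma sum_decreasingMatchings_insert {R : Type*} [AddCommMonoid R] {N : ℕ}
    {s Y D : Finset (Fin N)} {m : Fin N} (hm : ∀ i ∈ s, i < m) (hD : D ⊆ s)
    (F : (Fin N → Fin N) → R) :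
    ∑ f ∈ decreasingMatchings s Y (insert m D), F f =
      ∑ f ∈ decreasingMatchings s Y D, ∑ j ∈ (s \ Y) \ D.image f,
        F (Function.update f m j) := by
  have hmD : m ∉ D := fun h => lt_irrefl _ (hm m (hD h))
  have hne : ∀ i ∈ D, i ≠ m := fun i hi h => hmD (h ▸ hi)
  rw [Finset.sum_sigma']
  refine Finset.sum_bij' (fun f _ => ⟨Function.update f m m, f m⟩)
    (fun p _ => Function.update p.1 m p.2) ?_ ?_ ?_ ?_ ?_
  · intro f hf
    obtain ⟨h1, h2, h3⟩ := mem_decreasingMatchings.1 hf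
    rw [Finset.mem_sigma, mem_decreasingMatchings]
    refine ⟨⟨?_, ?_, ?_⟩, ?_⟩
    · intro i hi
      simpa [hne i hi] using h1 i (Finset.mem_insert_of_mem hi)
    · intro i hi j hj
      simpa [hne i hi, hne j hj] using
        h2 i (Finset.mem_insert_of_mem hi) j (Finset.mem_insert_of_mem hj)
    · intro i hi
      by_cases h : i = m
      · simp [h]
      · simpa [h] using h3 i (by simp [h, hi])
    · refine Finset.mem_sdiff.2 ⟨(h1 m (Finset.mem_insert_self _ _)).1, ?_⟩
      rw [Finset.mem_image]
      rintro ⟨i, hi, h⟩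
      simp only [Function.update_of_ne (hne i hi)] at h
      exact hne i hi (h2 i (Finset.mem_insert_of_mem hi) m (Finset.mem_insert_self _ _) h)
  · rintro ⟨f, j⟩ hp
    obtain ⟨hf, hj⟩ := Finset.mem_sigma.1 hp
    obtain ⟨h1, h2, h3⟩ := mem_decreasingMatchings.1 hf
    obtain ⟨hj1, hj2⟩ := Finset.mem_sdiff.1 hj
    have hj3 : ∀ i ∈ D, f i ≠ j := fun i hi h => hj2 (Finset.mem_image.2 ⟨i, hi, h⟩)
    rw [mem_decreasingMatchings]
    refine ⟨?_, ?_, ?_⟩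
    · intro i hi
      rcases Finset.mem_insert.1 hi with rfl | hi
      · simpa using ⟨Finset.mem_sdiff.1 hj1, hm j (Finset.mem_sdiff.1 hj1).1⟩
      · simpa [hne i hi] using h1 i hi
    · intro i hi k hk
      rw [Finset.mem_insert] at hi hk
      rcases hi with rfl | hi <;> rcases hk with rfl | hk
      · simp
      · intro h
        simp only [Function.update_self, Function.update_of_ne (hne k hk)] at h
        exact absurd h.symm (hj3 k hk)
      · intro h
        simp only [Function.update_self, Function.update_of_ne (hne i hi)] at h
        exact absurd h (hj3 i hi)
      · simpa [hne i hi, hne k hk] using h2 i hi k hk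
    · intro i hi
      rw [Finset.mem_insert, not_or] at hi
      simpa [hi.1] using h3 i hi.2
  · intro f _
    simp
  · rintro ⟨f, j⟩ hp
    have hfm : f m = m :=
      (mem_decreasingMatchings.1 (Finset.mem_sigma.1 hp).1).2.2 m hmD
    have : Function.update f m m = f := by
      conv_rhs => rw [← Function.update_eq_self m f, hfm]
    simp [this]
  · intro f _
    simp

/-- The antinormal ordering expansion for the ordered product over an arbitrary finset of
indices. -/
lemma orderedFinsetProd_add_eq_sum_matchings {R : Type*} [Ring R] [Algebra ℂ R] {N : ℕ}
    {a b : Fin N → R} {c : Fin N → Fin N → ℂ}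
    (ha : ∀ i j, a i * a j = a j * a i)
    (hb : ∀ i j, b i * b j = b j * b i)
    (hab : ∀ i j, a i * b j = b j * a i + algebraMap ℂ R (c i j)) (s : Finset (Fin N)) :
    orderedFinsetProd s (fun i => a i + b i) =
      ∑ Y ∈ s.powerset, ∑ D ∈ Y.powerset, ∑ f ∈ decreasingMatchings s Y D,
        ((-1 : ℂ) ^ D.card * ∏ i ∈ D, c i (f i)) •
          (orderedFinsetProd (Y \ D) a * orderedFinsetProd ((s \ Y) \ D.image f) b) := by
  induction s using Finset.induction_on_max with
  | empty =>
    have : decreasingMatchings (∅ : Finset (Fin N)) ∅ ∅ = {id} := by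
      ext f
      simp [mem_decreasingMatchings, funext_iff]
    simp [this, orderedFinsetProd]
  | insert m s hm ih =>
    have hms : m ∉ s := fun h => lt_irrefl _ (hm m h)
    rw [orderedFinsetProd_insert_max _ hm, ih, Finset.sum_powerset_insert hms,
      ← Finset.sum_add_distrib, Finset.sum_mul]
    refine Finset.sum_congr rfl fun Y hY => ?_
    rw [Finset.mem_powerset] at hY
    have hmY : m ∉ Y := fun h => hms (hY h)
    rw [Finset.sum_powerset_insert hmY, ← Finset.sum_add_distrib, ← Finset.sum_add_distrib,
      Finset.sum_mul]
    refine Finset.sum_congr rfl fun D hD => ?_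
    rw [Finset.mem_powerset] at hD
    have hDs : D ⊆ s := hD.trans hY
    have hmD : m ∉ D := fun h => hmY (hD h)
    rw [decreasingMatchings_insert_left fun i hi => hm i (hDs hi),
      decreasingMatchings_insert_insert hms, decreasingMatchings_insert_insert hms,
      sum_decreasingMatchings_insert hm hDs, ← Finset.sum_add_distrib, ← Finset.sum_add_distrib,
      Finset.sum_mul]
    refine Finset.sum_congr rfl fun f hf => ?_
    obtain ⟨h1, -, -⟩ := mem_decreasingMatchings.1 hf
    have hmf : m ∉ D.image f := by
      rw [Finset.mem_image]
      rintro ⟨i, hi, h⟩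
      exact hms (h ▸ (Finset.mem_sdiff.1 (h1 i hi).1).1)
    have e1 : (insert m s \ Y) \ D.image f = insert m ((s \ Y) \ D.image f) := by
      rw [Finset.insert_sdiff_of_notMem _ hmY, Finset.insert_sdiff_of_notMem _ hmf]
    have e2 : insert m Y \ D = insert m (Y \ D) := Finset.insert_sdiff_of_notMem _ hmD
    have e3 : insert m s \ insert m Y = s \ Y := by
      rw [Finset.insert_sdiff_insert, Finset.sdiff_insert_of_notMem hms]
    have e4 : insert m Y \ insert m D = Y \ D := by
      rw [Finset.insert_sdiff_insert, Finset.sdiff_insert_of_notMem hmY]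
    have hT : ∀ j, ((-1 : ℂ) ^ (insert m D).card *
          ∏ i ∈ insert m D, c i (Function.update f m j i)) •
        (orderedFinsetProd (Y \ D) a *
          orderedFinsetProd ((s \ Y) \ (insert m D).image (Function.update f m j)) b) =
        -(((-1 : ℂ) ^ D.card * ∏ i ∈ D, c i (f i)) • (orderedFinsetProd (Y \ D) a *
          (c m j • orderedFinsetProd (((s \ Y) \ D.image f).erase j) b))) := by
      intro j
      have hprod : ∏ i ∈ D, c i (Function.update f m j i) = ∏ i ∈ D, c i (f i) :=
        Finset.prod_congr rfl fun i hi => by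
          rw [Function.update_of_ne (ne_of_mem_of_not_mem hi hmD)]
      have himg : D.image (Function.update f m j) = D.image f :=
        Finset.image_congr fun i hi =>
          Function.update_of_ne (ne_of_mem_of_not_mem (Finset.mem_coe.1 hi) hmD) _ _
      rw [Finset.card_insert_of_notMem hmD, Finset.prod_insert hmD, hprod, Finset.image_insert,
        himg, Function.update_self, Finset.sdiff_insert, mul_smul_comm, smul_smul, ← neg_smul]
      congr 1
      ring
    rw [e1, e2, e3, e4, Finset.sum_congr rfl fun j _ => hT j, Finset.sum_neg_distrib,
      ← Finset.smul_sum, ← Finset.mul_sum, orderedFinsetProd_insert_right hb (by simp [hms]),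
      orderedFinsetProd_insert_right ha (by simp [hmY]), smul_mul_assoc, ← smul_neg, ← smul_add,
      ← smul_add, mul_add, mul_assoc _ _ (a m),
      orderedFinsetProd_mul_of_commutator hb (hab m) ((s \ Y) \ D.image f)]
    congr 1
    noncomm_ring

/-- antinormal ordering identity.  In an associative unital
`ℂ`-algebra `R`, given families `a`, `b` with `a i * a j = a j * a i`,
`b i * b j = b j * b i`, and `a i * b j = b j * a i + c i j • 1`, the ordered product
`(a 0 + b 0) ⋯ (a (N-1) + b (N-1))` expands as a sum over subsets `Y`, subsets
`D ⊆ Y` and injections `f : D → Yᶜ` with `f i < i`, encoded here as functions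
`f : Fin N → Fin N` that are the identity off `D`. -/
theorem antinormal_ordering_expansion
    (R : Type*) [Ring R] [Algebra ℂ R] (N : ℕ)
    (a b : Fin N → R) (c : Fin N → Fin N → ℂ)
    (ha : ∀ i j, a i * a j = a j * a i)
    (hb : ∀ i j, b i * b j = b j * b i)
    (hab : ∀ i j, a i * b j = b j * a i + algebraMap ℂ R (c i j)) :
    (List.ofFn (fun i => a i + b i)).prod =
      ∑ Y : Finset (Fin N), ∑ D : Finset (Fin N), ∑ f : Fin N → Fin N,
        if D ⊆ Y ∧ (∀ i ∈ D, f i ∉ Y ∧ f i < i) ∧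
            (∀ i ∈ D, ∀ j ∈ D, f i = f j → i = j) ∧ (∀ i ∉ D, f i = i) then
          ((-1 : ℂ) ^ D.card * ∏ i ∈ D, c i (f i)) •
            (orderedFinsetProd (Y \ D) a * orderedFinsetProd (Yᶜ \ D.image f) b)
        else 0 := by
  have hl : (List.ofFn (fun i => a i + b i)).prod =
      orderedFinsetProd Finset.univ (fun i => a i + b i) := by
    rw [orderedFinsetProd, Fin.sort_univ, List.ofFn_eq_map]
  rw [hl, orderedFinsetProd_add_eq_sum_matchings ha hb hab, Finset.powerset_univ]
  refine Finset.sum_congr rfl fun Y _ => ?_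
  rw [← Finset.filter_subset_univ, Finset.sum_filter]
  refine Finset.sum_congr rfl fun D _ => ?_
  by_cases hD : D ⊆ Y
  · simp [hD, decreasingMatchings, Finset.sum_filter, Finset.compl_eq_univ_sdiff]
  · simp [hD]
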